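/- In the Artin group of type I₂(m) with m = 2k even, the pair (H, G₁) satisfies Condition A with constant ζ = k − 1 and Condition B with constant ζ = k − 1. -/

import Mathlib

namespace GarsideOrder

variable {G : Type*} [Group G]

/-- `a ≤_R b` iff `b * a⁻¹ ∈ M`. -/
def leR (M : Submonoid G) (a b : G) : Prop := b * a⁻¹ ∈ M

/-- `a ≤_L b` iff `a⁻¹ * b ∈ M`. -/
def leL (M : Submonoid G) (a b : G) : Prop := a⁻¹ * b ∈ M

/-- Right divisors (in `M`) of `a`. -/
def DivR (M : Submonoid G) (a : G) : Set G := {b : G | b ∈ M ∧ leR M b a}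

/-- Left divisors (in `M`) of `a`. -/
def DivL (M : Submonoid G) (a : G) : Set G := {b : G | b ∈ M ∧ leL M b a}

/-- `a` is balanced if its sets of right and left divisors coincide. -/
def Balanced (M : Submonoid G) (a : G) : Prop := DivR M a = DivL M a

open Classical in
/-- The `N`-tail of `a`: the unique `b ∈ N` having the same right divisors lying in `N`
as `a` (w.r.t. the divisibility of the ambient monoid `M`). -/
noncomputable def tail (M N : Submonoid G) (a : G) : G :=
  if h : ∃ b : G, b ∈ N ∧
      {c : G | c ∈ N ∧ leR M c a} = {c : G | c ∈ N ∧ leR M c b} then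
    h.choose
  else 1

/-- Iterated stripping of alternating tails: first the `M₁`-tail, then the `N`-tail, etc. -/
noncomputable def strip (M M₁ N : Submonoid G) : ℕ → G → G
  | 0, a => a
  | i + 1, a =>
      strip M M₁ N i a *
        (tail M (if i % 2 = 0 then M₁ else N) (strip M M₁ N i a))⁻¹

/-- The breadth of `a`: the length of the alternating form of `a`, i.e. the least `p ≥ 1`
such that stripping alternating tails `p` times reaches `1`. -/
noncomputable def bh (M M₁ N : Submonoid G) (a : G) : ℕ :=
  sInf {p : ℕ | 1 ≤ p ∧ strip M M₁ N p a = 1}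

/-- The depth of `a`: `(bh a - 1)/2` if `bh a` is odd, `bh a / 2` if `bh a` is even;
in both cases this is `bh a / 2` with natural division. -/
noncomputable def dpt (M M₁ N : Submonoid G) (a : G) : ℕ := bh M M₁ N a / 2

/-- `a ∈ M` is unmovable if `Δ` does not right-divide it. -/
def Unmovable (M : Submonoid G) (Δ a : G) : Prop := a ∈ M ∧ ¬ leR M Δ a

/-- `α` is `(H, G₁)`-negative: its `Δ`-form is `a Δ^{-k}` with `k ≥ 1` and
`dpt a < dpt (Δ^k)`. -/
def Negative (M M₁ N : Submonoid G) (Δ : G) (α : G) : Prop :=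
  ∃ a : G, ∃ k : ℕ, Unmovable M Δ a ∧ 1 ≤ k ∧ α = a * (Δ ^ k)⁻¹ ∧
    dpt M M₁ N a < dpt M M₁ N (Δ ^ k)

/-- `α` is `(H, G₁)`-positive if `α⁻¹` is `(H, G₁)`-negative. -/
def Positive (M M₁ N : Submonoid G) (Δ : G) (α : G) : Prop :=
  Negative M M₁ N Δ α⁻¹

/-- The set `Θ` of theta elements `θ^k a₀`, `k ≥ 1`, `a₀ ∈ M₁`. -/
def thetaSet (M₁ : Submonoid G) (θ : G) : Set G :=
  {x : G | ∃ k : ℕ, 1 ≤ k ∧ ∃ a₀ ∈ M₁, x = θ ^ k * a₀}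

/-- `Θ̄ = Θ ∪ M₁`. -/
def thetaBar (M₁ : Submonoid G) (θ : G) : Set G := thetaSet M₁ θ ∪ (M₁ : Set G)

/-- Condition A with constant `ζ`: `dpt (Δ^k) = ζ k + 1` for all `k ≥ 1`. -/
def CondA (M M₁ N : Submonoid G) (Δ : G) (ζ : ℕ) : Prop :=
  ∀ k : ℕ, 1 ≤ k → dpt M M₁ N (Δ ^ k) = ζ * k + 1

/-- Condition B with constant `ζ`. -/
def CondB (M M₁ N : Submonoid G) (Δ θ : G) (ζ : ℕ) : Prop :=
  ∀ a b c : G, ∀ t : ℤ,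
    Unmovable M Δ a → Unmovable M Δ b →
    ¬(a ∈ thetaBar M₁ θ ∧ b ∈ thetaBar M₁ θ) →
    Unmovable M Δ c → a * b = c * Δ ^ t →
    ∃ ε : ℕ, ε ≤ 1 ∧
      (dpt M M₁ N c : ℤ) =
        (dpt M M₁ N a : ℤ) + (dpt M M₁ N b : ℤ) - (ζ : ℤ) * t - (ε : ℤ) ∧
      ((a ∈ thetaSet M₁ θ ∨ b ∈ thetaSet M₁ θ ∨ c ∈ M₁) → ε = 1)

/-- A Garside structure with group of fractions the subgroup `car`. -/
structure IsGarsideOn (car : Subgroup G) (M : Submonoid G) (Δ : G) : Prop where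
  M_sub : (M : Set G) ⊆ (car : Set G)
  delta_mem : Δ ∈ M
  units_trivial : ∀ x : G, x ∈ M → x⁻¹ ∈ M → x = 1
  noetherian : ∀ a ∈ M, ∃ n : ℕ, 1 ≤ n ∧ ∀ l : List G,
      (∀ x ∈ l, x ∈ M ∧ x ≠ 1) → l.prod = a → l.length ≤ n
  balanced : Balanced M Δ
  div_finite : (DivR M Δ).Finite
  div_gen_monoid : Submonoid.closure (DivR M Δ) = M
  div_gen_group : Subgroup.closure (DivR M Δ) = car
  meet : ∀ a ∈ car, ∀ b ∈ car, ∃ c ∈ car, leR M c a ∧ leR M c b ∧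
      ∀ d ∈ car, leR M d a → leR M d b → leR M d c
  join : ∀ a ∈ car, ∀ b ∈ car, ∃ c ∈ car, leR M a c ∧ leR M b c ∧
      ∀ d ∈ car, leR M a d → leR M b d → leR M c d

/-- The parabolic submonoid determined by `δ`: the submonoid generated by `Div(δ)`. -/
def parM (M : Submonoid G) (δ : G) : Submonoid G := Submonoid.closure (DivR M δ)

/-- The parabolic subgroup determined by `δ`: the subgroup generated by `Div(δ)`. -/
def parG (M : Submonoid G) (δ : G) : Subgroup G := Subgroup.closure (DivR M δ)

/-- `δ` determines a parabolic substructure of `(G, M, Δ)`. -/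
structure IsParabolic (M : Submonoid G) (Δ δ : G) : Prop where
  mem : δ ∈ M
  balanced : Balanced M δ
  div_eq : DivR M δ = DivR M Δ ∩ (parM M δ : Set G)

/-- The setting of Section 3: a Garside structure `(car, M, Δ)` together with two
parabolic substructures `(H, N, Λ)` (given by `lam`) and `(G₁, M₁, Δ₁)` (given by `δ1`),
with `N ≠ M`, `M₁ ≠ M`, `N ∪ M₁` generating `M`, `Δ` central, `Δ₁` central in `G₁`. -/
structure Setting (G : Type*) [Group G] where
  car : Subgroup G
  M : Submonoid G
  Δ : G
  δ1 : G
  lam : G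
  garside : IsGarsideOn car M Δ
  par1 : IsParabolic M Δ δ1
  parH : IsParabolic M Δ lam
  N_ne : parM M lam ≠ M
  M1_ne : parM M δ1 ≠ M
  unionGen : Submonoid.closure ((parM M lam : Set G) ∪ (parM M δ1 : Set G)) = M
  delta_central : ∀ g ∈ car, Δ * g = g * Δ
  delta1_central : ∀ g ∈ parG M δ1, δ1 * g = g * δ1

namespace Setting

variable (S : Setting G)

/-- The parabolic submonoid `M₁`. -/
def M₁ : Submonoid G := parM S.M S.δ1

/-- The parabolic submonoid `N`. -/
def Nsub : Submonoid G := parM S.M S.lam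

/-- The parabolic subgroup `G₁`. -/
def G₁ : Subgroup G := parG S.M S.δ1

/-- `θ = Δ Δ₁⁻¹`. -/
def theta : G := S.Δ * S.δ1⁻¹

/-- The set of `(H, G₁)`-negative elements. -/
def Neg : Set G := {α : G | Negative S.M S.M₁ S.Nsub S.Δ α}

/-- The set of `(H, G₁)`-positive elements. -/
def Pos : Set G := {α : G | α⁻¹ ∈ S.Neg}

/-- Condition A. -/
def condA (ζ : ℕ) : Prop := CondA S.M S.M₁ S.Nsub S.Δ ζ

/-- Condition B. -/
def condB (ζ : ℕ) : Prop := CondB S.M S.M₁ S.Nsub S.Δ S.theta ζ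

/-- `(H, G₁)` is a Dehornoy structure: `PP ⊆ P`, `G₁ P G₁ ⊆ P`, and the group is the
disjoint union of `P`, `P⁻¹` and `G₁`. -/
def IsDehornoy : Prop :=
  (∀ α ∈ S.Pos, ∀ β ∈ S.Pos, α * β ∈ S.Pos) ∧
  (∀ g₁ ∈ S.G₁, ∀ α ∈ S.Pos, ∀ g₂ ∈ S.G₁, g₁ * α * g₂ ∈ S.Pos) ∧
  (∀ α ∈ S.car, α ∈ S.Pos ∨ α ∈ S.Neg ∨ α ∈ S.G₁) ∧
  (∀ α : G, ¬(α ∈ S.Pos ∧ α ∈ S.Neg)) ∧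
  (∀ α : G, ¬(α ∈ S.Pos ∧ α ∈ S.G₁)) ∧
  (∀ α : G, ¬(α ∈ S.Neg ∧ α ∈ S.G₁))

end Setting

end GarsideOrder


namespace DihedralArtin

/-- The alternating word `x y x y ⋯` of length `m`. -/
def alt {α : Type*} [Monoid α] (x y : α) : ℕ → α
  | 0 => 1
  | k + 1 => x * alt y x k

/-- The defining relation of the Artin group of type `I₂(m)`:
`Π(s, t, m) = Π(t, s, m)`, with `s = of true` and `t = of false`. -/
def dihedralRel (m : ℕ) : Set (FreeGroup Bool) :=
  {alt (FreeGroup.of true) (FreeGroup.of false) m *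
    (alt (FreeGroup.of false) (FreeGroup.of true) m)⁻¹}

/-- The Artin group of type `I₂(m)`. -/
abbrev DG (m : ℕ) := PresentedGroup (dihedralRel m)

/-- The generator `s`. -/
def sA (m : ℕ) : DG m := PresentedGroup.of true

/-- The generator `t`. -/
def tA (m : ℕ) : DG m := PresentedGroup.of false

/-- The Artin monoid: the submonoid generated by `{s, t}`. -/
def Md (m : ℕ) : Submonoid (DG m) := Submonoid.closure {sA m, tA m}

/-- The submonoid generated by `t`. -/
def M₁d (m : ℕ) : Submonoid (DG m) := Submonoid.closure {tA m}

/-- The submonoid generated by `s`. -/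
def Nd (m : ℕ) : Submonoid (DG m) := Submonoid.closure {sA m}

/-- The subgroup generated by `t`. -/
def G₁d (m : ℕ) : Subgroup (DG m) := Subgroup.closure {tA m}

/-- The subgroup generated by `s`. -/
def Hd (m : ℕ) : Subgroup (DG m) := Subgroup.closure {sA m}

/-- `Ω = Π(s, t, m)` in the Artin group of type `I₂(m)`. -/
def Ωd (m : ℕ) : DG m := alt (sA m) (tA m) m

end DihedralArtin

namespace DihedralArtin

/-- The alternating word `x, !x, x, …` of length `n`. -/
def altList (x : Bool) : ℕ → List Bool
  | 0 => []
  | n + 1 => x :: altList (!x) n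

@[simp] lemma length_altList (x : Bool) (n : ℕ) : (altList x n).length = n := by
  induction n generalizing x with
  | zero => rfl
  | succ n ih => simp [altList, ih]

lemma altList_add (x : Bool) (i j : ℕ) :
    altList x (i + j) = altList x i ++ altList (not^[i] x) j := by
  induction i generalizing x with
  | zero => simp [altList]
  | succ i ih => rw [Nat.succ_add]; simp [altList, ih]

lemma head?_altList (x : Bool) {n : ℕ} (hn : 0 < n) : (altList x n).head? = some x := by
  obtain ⟨n, rfl⟩ := Nat.exists_eq_succ_of_ne_zero hn.ne'
  rfl

lemma getLast?_altList (x : Bool) (n : ℕ) :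
    (altList x (n + 1)).getLast? = some (not^[n] x) := by
  rw [altList_add]; simp [altList]

lemma iterate_not_two_mul (k : ℕ) (x : Bool) : not^[2 * k] x = x := by
  rw [Bool.involutive_not.iterate_even (even_two_mul k)]; rfl

lemma iterate_not_two_mul_sub_one {k : ℕ} (hk : 0 < k) (x : Bool) :
    not^[2 * k - 1] x = !x := by
  have h := iterate_not_two_mul k x
  rw [show 2 * k = (2 * k - 1) + 1 by omega, Function.iterate_succ_apply'] at h
  exact Bool.not_inj (by rw [h, Bool.not_not])

/-- A word is reduced if it contains no alternating factor of length `m`. -/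
def Reduced (m : ℕ) (w : List Bool) : Prop := ∀ x, ¬ altList x m <:+: w

lemma Reduced.of_infix {m : ℕ} {v w : List Bool} (hw : Reduced m w) (h : v <:+: w) :
    Reduced m v := fun x hx => hw x (hx.trans h)

lemma reduced_nil {m : ℕ} (hm : 0 < m) : Reduced m [] := by
  intro x hx
  have := hx.length_le
  simp at this
  omega

lemma reduced_cons {m : ℕ} (hm : 0 < m) {x : Bool} {w : List Bool} :
    Reduced m (x :: w) ↔ Reduced m w ∧ ¬ altList x m <+: x :: w := by
  constructor
  · exact fun h => ⟨h.of_infix (List.suffix_cons x w).isInfix, fun h' => h x h'.isInfix⟩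
  · rintro ⟨h, h'⟩ y hy
    rcases List.infix_cons_iff.1 hy with hy | hy
    · have : y = x := by
        obtain ⟨q, hq⟩ := hy
        obtain ⟨m, rfl⟩ := Nat.exists_eq_succ_of_ne_zero hm.ne'
        simp only [altList, List.cons_append, List.cons.injEq] at hq
        exact hq.1
      subst this
      exact h' hy
    · exact h y hy

/-- Prefixing an alternating word of length less than `m` which is not continued by the
first letter of a reduced word gives a reduced word. -/
lemma reduced_altList_append {m i : ℕ} (hi : i < m) {x : Bool} {z : List Bool}
    (hz : Reduced m z) (h : z.head? ≠ some (not^[i] x)) : Reduced m (altList x i ++ z) := by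
  induction i generalizing x with
  | zero => simpa [altList] using hz
  | succ i ih =>
    rw [altList, List.cons_append, reduced_cons (by omega)]
    refine ⟨ih (by omega) h, ?_⟩
    rw [← List.cons_append, ← altList, show m = (i + 1) + (m - (i + 1)) by omega, altList_add,
      List.prefix_append_right_inj]
    rintro ⟨q, rfl⟩
    apply h
    rw [List.head?_append, head?_altList _ (by omega)]
    rfl

/-- Left multiplication by a letter on reduced words, modulo the Garside element. -/
def letterAct (m : ℕ) (x : Bool) (w : List Bool) : List Bool :=
  if altList x m <+: x :: w then (x :: w).drop m else x :: w

lemma Reduced.letterAct {m : ℕ} (hm : 0 < m) (x : Bool) {w : List Bool} (hw : Reduced m w) :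
    Reduced m (letterAct m x w) := by
  unfold DihedralArtin.letterAct
  split_ifs with h
  · obtain ⟨m, rfl⟩ := Nat.exists_eq_succ_of_ne_zero hm.ne'
    exact hw.of_infix (by simpa using (List.drop_suffix m w).isInfix)
  · exact (reduced_cons hm).2 ⟨hw, h⟩

lemma foldr_letterAct_of_reduced {m : ℕ} (hm : 0 < m) {l z : List Bool}
    (h : Reduced m (l ++ z)) : l.foldr (letterAct m) z = l ++ z := by
  induction l with
  | nil => rfl
  | cons x l ih =>
    rw [List.cons_append, reduced_cons hm] at h
    rw [List.foldr_cons, ih h.1, letterAct, if_neg h.2]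
    rfl

/-- A reduced word splits off its maximal alternating prefix with given first letter. -/
lemma Reduced.exists_altList_append {m : ℕ} (x : Bool) {w : List Bool}
    (hw : Reduced m w) :
    ∃ r z, w = altList x r ++ z ∧ r < m ∧ z.head? ≠ some (not^[r] x) := by
  suffices H : ∃ r z, w = altList x r ++ z ∧ z.head? ≠ some (not^[r] x) by
    obtain ⟨r, z, rfl, h⟩ := H
    refine ⟨r, z, rfl, ?_, h⟩
    by_contra hr
    apply hw x
    rw [show r = m + (r - m) by omega, altList_add, List.append_assoc]
    exact (List.prefix_append _ _).isInfix
  clear hw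
  induction w generalizing x with
  | nil => exact ⟨0, [], rfl, by simp⟩
  | cons y w ih =>
    by_cases hy : y = x
    · subst hy
      obtain ⟨r, z, rfl, h⟩ := ih (!y)
      exact ⟨r + 1, z, rfl, h⟩
    · exact ⟨0, y :: w, rfl, by simpa using hy⟩

/-- Alternating words of length `2 * k` act trivially on reduced words. -/
lemma foldr_letterAct_altList {k : ℕ} (hk : 0 < k) (x : Bool) {w : List Bool}
    (hw : Reduced (2 * k) w) : (altList x (2 * k)).foldr (letterAct (2 * k)) w = w := by
  obtain ⟨r, z, rfl, hr, hz⟩ := hw.exists_altList_append x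
  have hzr : Reduced (2 * k) z := hw.of_infix (List.suffix_append _ _).isInfix
  have hflip : not^[2 * k - r - 1] (!(not^[r] x)) = x := by
    rw [← Function.iterate_succ_apply, ← Function.iterate_add_apply,
      show (2 * k - r - 1).succ + r = 2 * k by omega, iterate_not_two_mul]
  have hjoin : altList (!(not^[r] x)) (2 * k - r - 1) ++ (altList x r ++ z) =
      altList (!(not^[r] x)) (2 * k - 1) ++ z := by
    rw [show 2 * k - 1 = (2 * k - r - 1) + r by omega, altList_add, hflip, List.append_assoc]
  have hlong : Reduced (2 * k) (altList (!(not^[r] x)) (2 * k - 1) ++ z) := by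
    refine reduced_altList_append (by omega) hzr ?_
    rw [iterate_not_two_mul_sub_one hk, Bool.not_not]
    exact hz
  have hlong' := hlong
  rw [← hjoin] at hlong'
  have hfull : not^[r] x :: (altList (!(not^[r] x)) (2 * k - 1) ++ z) =
      altList (not^[r] x) (2 * k) ++ z := by
    conv_rhs => rw [show 2 * k = (2 * k - 1) + 1 by omega]
    rfl
  conv_lhs => rw [show altList x (2 * k) = altList x r ++
    (not^[r] x :: altList (!(not^[r] x)) (2 * k - r - 1)) by
      conv_lhs => rw [show 2 * k = r + ((2 * k - r - 1) + 1) by omega, altList_add]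
      rfl]
  rw [List.foldr_append, List.foldr_cons,
    foldr_letterAct_of_reduced (by omega) hlong', hjoin, letterAct, hfull,
    if_pos (List.prefix_append _ _), List.drop_left' (length_altList _ _),
    foldr_letterAct_of_reduced (by omega) hw]

/-- The action of a letter as a self-map of the set of reduced words. -/
def reducedAct {k : ℕ} (hk : 0 < k) (x : Bool) (w : {w // Reduced (2 * k) w}) :
    {w // Reduced (2 * k) w} :=
  ⟨letterAct (2 * k) x w.1, w.2.letterAct (by omega) x⟩

lemma coe_foldr_reducedAct {k : ℕ} (hk : 0 < k) (l : List Bool)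
    (w : {w // Reduced (2 * k) w}) :
    (l.foldr (reducedAct hk) w).1 = l.foldr (letterAct (2 * k)) w.1 := by
  induction l with
  | nil => rfl
  | cons x l ih => rw [List.foldr_cons, List.foldr_cons, ← ih]; rfl

lemma reducedAct_bijective {k : ℕ} (hk : 0 < k) (x : Bool) :
    Function.Bijective (reducedAct hk x) := by
  have key (y) (w : {w // Reduced (2 * k) w}) :
      (altList y (2 * k)).foldr (reducedAct hk) w = w :=
    Subtype.ext ((coe_foldr_reducedAct hk _ w).trans (foldr_letterAct_altList hk y w.2))
  have hsplit := show 2 * k = (2 * k - 1) + 1 by omega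
  constructor
  · intro v w h
    have hx : altList (!x) (2 * k) = altList (!x) (2 * k - 1) ++ [x] := by
      conv_lhs => rw [hsplit, altList_add, iterate_not_two_mul_sub_one hk, Bool.not_not]
      rfl
    rw [← key (!x) v, ← key (!x) w, hx, List.foldr_append, List.foldr_append]
    simp [h]
  · intro w
    refine ⟨(altList (!x) (2 * k - 1)).foldr (reducedAct hk) w, ?_⟩
    have hx : altList x (2 * k) = x :: altList (!x) (2 * k - 1) := by
      conv_lhs => rw [hsplit]
      rfl
    conv_rhs => rw [← key x w, hx]
    rfl

/-- The generator of the Artin group with a given name. -/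
def gen (m : ℕ) (x : Bool) : DG m := PresentedGroup.of x

/-- The element represented by a positive word. -/
def evalWord (m : ℕ) (w : List Bool) : DG m := (w.map (gen m)).prod

@[simp] lemma evalWord_nil (m : ℕ) : evalWord m [] = 1 := rfl

@[simp] lemma evalWord_append (m : ℕ) (v w : List Bool) :
    evalWord m (v ++ w) = evalWord m v * evalWord m w := by simp [evalWord]

@[simp] lemma evalWord_cons (m : ℕ) (x : Bool) (w : List Bool) :
    evalWord m (x :: w) = gen m x * evalWord m w := by simp [evalWord]

lemma evalWord_replicate (m n : ℕ) (x : Bool) :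
    evalWord m (List.replicate n x) = gen m x ^ n := by simp [evalWord]

lemma prod_map_altList {α : Type*} [Monoid α] (g : Bool → α) (x : Bool) (n : ℕ) :
    ((altList x n).map g).prod = alt (g x) (g !x) n := by
  induction n generalizing x with
  | zero => rfl
  | succ n ih => simp [altList, alt, ih]

lemma lift_rel_eq_one {Q : Type*} [Group Q] {m : ℕ} {g : Bool → Q}
    (h : ((altList true m).map g).prod = ((altList false m).map g).prod) :
    ∀ r ∈ dihedralRel m, FreeGroup.lift g r = 1 := by
  rintro r rfl
  have hmap (x : Bool) : FreeGroup.lift g (alt (FreeGroup.of x) (FreeGroup.of !x) m) =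
      ((altList x m).map g).prod := by
    rw [← prod_map_altList, map_list_prod, List.map_map]
    congr 2
    ext; simp
  rw [map_mul, map_inv, mul_inv_eq_one]
  exact (hmap true).trans (h.trans (hmap false).symm)

lemma toGroup_evalWord {Q : Type*} [Group Q] {m : ℕ} {g : Bool → Q}
    (h : ∀ r ∈ dihedralRel m, FreeGroup.lift g r = 1) (w : List Bool) :
    PresentedGroup.toGroup h (evalWord m w) = (w.map g).prod := by
  induction w with
  | nil => simp
  | cons x w ih => simp [ih, gen]

lemma length_eq_of_evalWord_eq {m : ℕ} {v w : List Bool} (h : evalWord m v = evalWord m w) :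
    v.length = w.length := by
  have hrel := lift_rel_eq_one (m := m) (g := fun _ => Multiplicative.ofAdd (1 : ℤ)) (by simp)
  have := congrArg (PresentedGroup.toGroup hrel) h
  rw [toGroup_evalWord, toGroup_evalWord] at this
  simpa [← ofAdd_nsmul] using this

lemma length_foldr_letterAct_le {m : ℕ} (l : List Bool) :
    (l.foldr (letterAct m) []).length ≤ l.length := by
  induction l with
  | nil => simp
  | cons x l ih =>
    rw [List.foldr_cons, letterAct]
    split_ifs <;> simp <;> omega

lemma foldr_letterAct_eq_self {m : ℕ} (hm : 0 < m) (l : List Bool)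
    (h : l.length ≤ (l.foldr (letterAct m) []).length) : l.foldr (letterAct m) [] = l := by
  induction l with
  | nil => rfl
  | cons x l ih =>
    have hl := length_foldr_letterAct_le (m := m) l
    rw [List.foldr_cons, letterAct] at h ⊢
    split_ifs at h ⊢
    · simp at h; omega
    · rw [ih (by simpa using h)]

/-- A reduced word is the only positive word representing its element. -/
lemma eq_of_evalWord_eq {k : ℕ} (hk : 0 < k) {v w : List Bool} (hw : Reduced (2 * k) w)
    (h : evalWord (2 * k) v = evalWord (2 * k) w) : v = w := by
  let g : Bool → Equiv.Perm {w // Reduced (2 * k) w} :=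
    fun x => Equiv.ofBijective _ (reducedAct_bijective hk x)
  have happ (l : List Bool) (z) :
      ((((l.map g).prod : Equiv.Perm _) z : {w // Reduced (2 * k) w}) : List Bool) =
        l.foldr (letterAct (2 * k)) z.1 := by
    rw [← coe_foldr_reducedAct hk]
    congr 1
    induction l with
    | nil => rfl
    | cons x l ih =>
      rw [List.map_cons, List.prod_cons, Equiv.Perm.mul_apply, ih, List.foldr_cons]
      rfl
  have hg (x) : ((altList x (2 * k)).map g).prod = 1 := by
    ext1 z
    exact Subtype.ext ((happ _ z).trans (foldr_letterAct_altList hk x z.2))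
  have hrel := lift_rel_eq_one (m := 2 * k) (g := g) (by rw [hg, hg])
  have h1 := congrArg (PresentedGroup.toGroup hrel) h
  rw [toGroup_evalWord, toGroup_evalWord] at h1
  have h2 : v.foldr (letterAct (2 * k)) [] = w := by
    have := happ v ⟨[], reduced_nil (by omega)⟩
    rw [h1, happ] at this
    simpa [foldr_letterAct_of_reduced (z := []) (show 0 < 2 * k by omega) (by simpa using hw)]
      using this.symm
  rw [← foldr_letterAct_eq_self (m := 2 * k) (by omega) v 
    (by rw [h2, length_eq_of_evalWord_eq h]), h2]

/-- The number of maximal blocks of the letter `true` in a word. -/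
def sBlocks : List Bool → ℕ
  | [] => 0
  | x :: w => sBlocks w + if x = true ∧ w.head? ≠ some true then 1 else 0

lemma sBlocks_append (v w : List Bool) :
    sBlocks (v ++ w) + (if v.getLast? = some true ∧ w.head? = some true then 1 else 0) =
      sBlocks v + sBlocks w := by
  induction v with
  | nil => simp [sBlocks]
  | cons x v ih =>
    rcases v with _ | ⟨y, v⟩
    · rcases x <;> by_cases h : w.head? = some true <;> simp [sBlocks, h, add_comm]
    · have hcons (l : List Bool) : sBlocks (x :: y :: l) =
          sBlocks (y :: l) + if x = true ∧ y = false then 1 else 0 := by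
        rcases x <;> rcases y <;> simp [sBlocks]
      rw [List.getLast?_cons_cons]
      simp only [List.cons_append, hcons] at ih ⊢
      omega

lemma sBlocks_eq_zero {w : List Bool} : sBlocks w = 0 ↔ true ∉ w := by
  induction w with
  | nil => simp [sBlocks]
  | cons x w ih =>
    rcases x
    · simp [sBlocks, ih]
    · rcases w with _ | ⟨y, w⟩
      · simp [sBlocks]
      · rcases y <;> simp_all [sBlocks]

lemma sBlocks_replicate_true (n : ℕ) : sBlocks (List.replicate (n + 1) true) = 1 := by
  induction n with
  | zero => rfl
  | succ n ih => rw [List.replicate_succ, sBlocks, ih]; simp [List.replicate_succ]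

lemma sBlocks_altList (k : ℕ) (x : Bool) : sBlocks (altList x (2 * k)) = k := by
  induction k with
  | zero => rfl
  | succ k ih =>
    rw [show 2 * (k + 1) = 2 * k + 1 + 1 by ring]
    rcases k with _ | k
    · rcases x <;> rfl
    · rw [show 2 * (k + 1) = 2 * k + 1 + 1 by ring] at ih ⊢
      rcases x <;> simp_all [altList, sBlocks]

/-- A word splits off its maximal final block of a given letter. -/
lemma exists_append_replicate (x : Bool) (w : List Bool) :
    ∃ v n, w = v ++ List.replicate n x ∧ v.getLast? ≠ some x := by
  induction w using List.reverseRecOn with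
  | nil => exact ⟨[], 0, rfl, by simp⟩
  | append_singleton w y ih =>
    by_cases hy : y = x
    · subst hy
      obtain ⟨v, n, rfl, hv⟩ := ih
      exact ⟨v, n + 1, by rw [List.replicate_succ', List.append_assoc], hv⟩
    · exact ⟨w ++ [y], 0, by simp, by simpa using hy⟩

lemma evalWord_altList (m : ℕ) (x : Bool) : evalWord m (altList x m) = Ωd m := by
  have htrue : evalWord m (altList true m) = Ωd m := prod_map_altList (gen m) true m
  rcases x
  · rw [← htrue, eq_comm, ← mul_inv_eq_one]
    have h := PresentedGroup.one_of_mem (rels := dihedralRel m) (Set.mem_singleton _)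
    rw [map_mul, map_inv] at h
    have hmk (x : Bool) : PresentedGroup.mk (dihedralRel m)
        (alt (FreeGroup.of x) (FreeGroup.of !x) m) = evalWord m (altList x m) := by
      rw [← prod_map_altList, map_list_prod, List.map_map]
      rfl
    rw [← hmk, ← hmk]
    exact h
  · exact htrue

lemma altList_two_mul_append (x : Bool) (k : ℕ) :
    altList x (2 * k) ++ [x] = x :: altList (!x) (2 * k) := by
  have h := altList_add x (2 * k) 1
  simp only [altList, iterate_not_two_mul] at h
  exact h.symm

lemma commute_omega (k : ℕ) (w : List Bool) :
    Commute (Ωd (2 * k)) (evalWord (2 * k) w) := by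
  induction w with
  | nil => exact Commute.one_right _
  | cons x w ih =>
    rw [evalWord_cons]
    refine Commute.mul_right ?_ ih
    have h := altList_two_mul_append x k
    have := congrArg (evalWord (2 * k)) h
    rw [commute_iff_eq]
    simpa [evalWord_altList] using this

lemma mem_Md {m : ℕ} {a : DG m} : a ∈ Md m ↔ ∃ w, evalWord m w = a := by
  constructor
  · intro h
    induction h using Submonoid.closure_induction with
    | mem x hx =>
      rcases hx with rfl | rfl
      · exact ⟨[true], by simp [gen, sA]⟩
      · exact ⟨[false], by simp [gen, tA]⟩
    | one => exact ⟨[], rfl⟩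
    | mul a b _ _ ha hb =>
      obtain ⟨v, rfl⟩ := ha
      obtain ⟨w, rfl⟩ := hb
      exact ⟨v ++ w, evalWord_append m v w⟩
  · rintro ⟨w, rfl⟩
    refine Submonoid.list_prod_mem _ fun a ha => Submonoid.subset_closure ?_
    obtain ⟨x, -, rfl⟩ := List.mem_map.1 ha
    rcases x
    · exact Or.inr rfl
    · exact Or.inl rfl

open GarsideOrder

lemma leR_gen_pow_iff {k : ℕ} (hk : 0 < k) {x : Bool} {w : List Bool}
    (hw : Reduced (2 * k) w) (hx : w.getLast? ≠ some x) {i n : ℕ} :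
    leR (Md (2 * k)) (gen (2 * k) x ^ i) (evalWord (2 * k) w * gen (2 * k) x ^ n) ↔ i ≤ n := by
  rw [leR, mem_Md]
  constructor
  · rintro ⟨u, hu⟩
    by_contra! hlt
    obtain ⟨j, rfl⟩ := Nat.exists_eq_add_of_lt hlt
    rw [eq_mul_inv_iff_mul_eq, show n + j + 1 = (j + 1) + n by ring, pow_add, ← mul_assoc,
      mul_left_inj, ← evalWord_replicate, ← evalWord_append] at hu
    rw [← eq_of_evalWord_eq hk hw hu] at hx
    simp [List.replicate_succ'] at hx
  · intro h
    refine ⟨w ++ List.replicate (n - i) x, ?_⟩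
    rw [evalWord_append, evalWord_replicate, pow_sub _ h, mul_assoc]

lemma tail_mul_gen_pow {k : ℕ} (hk : 0 < k) {x : Bool} {w : List Bool}
    (hw : Reduced (2 * k) w) (hx : w.getLast? ≠ some x) (n : ℕ) :
    tail (Md (2 * k)) (Submonoid.closure {gen (2 * k) x})
      (evalWord (2 * k) w * gen (2 * k) x ^ n) = gen (2 * k) x ^ n := by
  have hpow (i j : ℕ) : leR (Md (2 * k)) (gen (2 * k) x ^ i) (gen (2 * k) x ^ j) ↔ i ≤ j := by
    simpa using leR_gen_pow_iff hk (reduced_nil (by omega)) (x := x) (by simp) (i := i) (n := j)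
  have hex : ∃ b : DG (2 * k), b ∈ Submonoid.closure {gen (2 * k) x} ∧
      {c | c ∈ Submonoid.closure {gen (2 * k) x} ∧
        leR (Md (2 * k)) c (evalWord (2 * k) w * gen (2 * k) x ^ n)} =
      {c | c ∈ Submonoid.closure {gen (2 * k) x} ∧ leR (Md (2 * k)) c b} := by
    refine ⟨gen (2 * k) x ^ n, pow_mem (Submonoid.mem_closure_singleton_self) n, ?_⟩
    ext c
    refine and_congr_right fun hc => ?_
    obtain ⟨i, rfl⟩ := Submonoid.mem_closure_singleton.1 hc
    rw [leR_gen_pow_iff hk hw hx, hpow]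
  rw [tail, dif_pos hex]
  obtain ⟨hmem, hset⟩ := hex.choose_spec
  obtain ⟨i, hi⟩ := Submonoid.mem_closure_singleton.1 hmem
  rw [← hi] at hset ⊢
  have hiff (j : ℕ) : j ≤ n ↔ j ≤ i := by
    have := Set.ext_iff.1 hset (gen (2 * k) x ^ j)
    simpa [pow_mem (Submonoid.mem_closure_singleton_self) j, leR_gen_pow_iff hk hw hx,
      hpow] using this
  rw [le_antisymm ((hiff i).2 le_rfl) ((hiff n).1 le_rfl)]

lemma strip_mul_gen_pow {k : ℕ} (hk : 0 < k) {w : List Bool}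
    (hw : Reduced (2 * k) w) (hlast : w.getLast? ≠ some false) (n p : ℕ) :
    ∃ v, Reduced (2 * k) v ∧ strip (Md (2 * k)) (M₁d (2 * k)) (Nd (2 * k)) (p + 1)
        (evalWord (2 * k) w * gen (2 * k) false ^ n) = evalWord (2 * k) v ∧
      sBlocks v = sBlocks w - (p + 1) / 2 ∧ (p % 2 = 0 → v.getLast? ≠ some false) := by
  induction p with
  | zero =>
    refine ⟨w, hw, ?_, by simp, fun _ => hlast⟩
    have := tail_mul_gen_pow hk hw hlast n
    rw [strip, strip, if_pos rfl, M₁d, show tA (2 * k) = gen (2 * k) false from rfl, this,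
      mul_inv_cancel_right]
  | succ p ih =>
    obtain ⟨v, hv, hstrip, hblocks, hend⟩ := ih
    obtain ⟨x, hx⟩ : ∃ x : Bool, x = decide ((p + 1) % 2 ≠ 0) := ⟨_, rfl⟩
    obtain ⟨u, i, rfl, hu⟩ := exists_append_replicate x v
    have hur : Reduced (2 * k) u := hv.of_infix (List.prefix_append _ _).isInfix
    refine ⟨u, hur, ?_, ?_, ?_⟩
    · rw [strip, hstrip, show (if (p + 1) % 2 = 0 then M₁d (2 * k) else Nd (2 * k)) =
        Submonoid.closure {gen (2 * k) x} by
          subst hx; split_ifs with h <;> simp [h, M₁d, Nd, gen, tA, sA]]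
      rw [evalWord_append, evalWord_replicate, tail_mul_gen_pow hk hur hu, mul_inv_cancel_right]
    · have happ := sBlocks_append u (List.replicate i x)
      rw [if_neg (by
        rintro ⟨h1, h2⟩
        rcases i with _ | i
        · simp at h2
        · simp [List.replicate_succ] at h2
          exact hu (h2 ▸ h1)), hblocks] at happ
      rcases Nat.mod_two_eq_zero_or_one p with hp | hp
      · obtain rfl : x = true := by rw [hx]; simp; omega
        rcases i with _ | i
        · have hnil : u = [] := by
            have h1 := hend hp
            rcases List.eq_nil_or_concat u with h | ⟨l, y, rfl⟩
            · exact h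
            · rcases y <;> simp_all
          subst hnil
          simp [sBlocks] at happ ⊢
          omega
        · rw [sBlocks_replicate_true] at happ
          omega
      · obtain rfl : x = false := by rw [hx]; simp; omega
        rw [(sBlocks_eq_zero (w := List.replicate i false)).2 (by simp)] at happ
        omega
    · intro h
      obtain rfl : x = false := by rw [hx]; simp; omega
      exact hu

lemma dpt_mul_gen_pow {k : ℕ} (hk : 0 < k) {w : List Bool}
    (hw : Reduced (2 * k) w) (hlast : w.getLast? ≠ some false) (n : ℕ) :
    dpt (Md (2 * k)) (M₁d (2 * k)) (Nd (2 * k))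
      (evalWord (2 * k) w * gen (2 * k) false ^ n) = sBlocks w := by
  have hstrip := strip_mul_gen_pow hk hw hlast n
  have hmem : 2 * sBlocks w + 1 ∈ {p : ℕ | 1 ≤ p ∧
      strip (Md (2 * k)) (M₁d (2 * k)) (Nd (2 * k)) p
        (evalWord (2 * k) w * gen (2 * k) false ^ n) = 1} := by
    refine ⟨by omega, ?_⟩
    obtain ⟨v, -, hv, hblocks, hend⟩ := hstrip (2 * sBlocks w)
    have hv0 : sBlocks v = 0 := by omega
    have hv1 := hend (by omega)
    rw [sBlocks_eq_zero] at hv0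
    rcases List.eq_nil_or_concat v with rfl | ⟨l, y, rfl⟩
    · exact hv
    · rcases y <;> simp_all
  have hle := Nat.sInf_le hmem
  obtain ⟨h1, h2⟩ := Nat.sInf_mem ⟨_, hmem⟩
  rw [dpt, bh]
  set q := sInf {p : ℕ | 1 ≤ p ∧ strip (Md (2 * k)) (M₁d (2 * k)) (Nd (2 * k)) p
        (evalWord (2 * k) w * gen (2 * k) false ^ n) = 1}
  obtain ⟨q', hq⟩ : ∃ q', q = q' + 1 := ⟨q - 1, by omega⟩
  rw [hq] at h2 hle ⊢
  obtain ⟨v, -, hv, hblocks, -⟩ := hstrip q'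
  have hv' : v = [] := eq_of_evalWord_eq hk (reduced_nil (by omega)) (hv.symm.trans h2)
  subst hv'
  simp only [sBlocks] at hblocks
  omega

lemma dpt_evalWord {k : ℕ} (hk : 0 < k) {w : List Bool} (hw : Reduced (2 * k) w) :
    dpt (Md (2 * k)) (M₁d (2 * k)) (Nd (2 * k)) (evalWord (2 * k) w) = sBlocks w := by
  obtain ⟨v, n, rfl, hv⟩ := exists_append_replicate false w
  have happ := sBlocks_append v (List.replicate n false)
  rw [(sBlocks_eq_zero (w := List.replicate n false)).2 (by simp), if_neg (by
    rcases n with _ | n <;> simp [List.replicate_succ])] at happ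
  rw [evalWord_append, evalWord_replicate,
    dpt_mul_gen_pow hk (hw.of_infix (List.prefix_append _ _).isInfix) hv]
  omega

/-- An occurrence of an alternating word of length `2 * k` which cannot be shifted left. -/
lemma exists_leftmost_altList {k : ℕ} {w : List Bool} (hw : ¬ Reduced (2 * k) w) :
    ∃ x p q, w = p ++ (altList x (2 * k) ++ q) ∧ p.getLast? ≠ some (!x) := by
  simp only [Reduced, not_forall, not_not] at hw
  obtain ⟨x, p, q, rfl⟩ := hw
  induction p using List.reverseRecOn generalizing x q with
  | nil => exact ⟨x, [], q, by simp, by simp⟩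
  | append_singleton p y ih =>
    by_cases hy : y = !x
    · subst hy
      have h := altList_two_mul_append (!x) k
      rw [Bool.not_not] at h
      have heq : p ++ [!x] ++ altList x (2 * k) ++ q =
          p ++ altList (!x) (2 * k) ++ ((!x) :: q) := by
        simpa using congrArg (fun l => p ++ l ++ q) h.symm
      rw [heq]
      exact ih _ _
    · exact ⟨x, p ++ [y], q, by simp, by simpa using hy⟩

/-- If two reduced words have a non-reduced product, then an alternating word of length
`2 * k` straddles the junction. -/
lemma exists_straddle {k : ℕ} {u v : List Bool} (hu : Reduced (2 * k) u)
    (hv : Reduced (2 * k) v) (huv : ¬ Reduced (2 * k) (u ++ v)) :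
    ∃ x p q i, 0 < i ∧ i < 2 * k ∧ u = p ++ altList x i ∧
      v = altList (not^[i] x) (2 * k - i) ++ q ∧ p.getLast? ≠ some (!x) := by
  obtain ⟨x, p, q, h, hp⟩ := exists_leftmost_altList huv
  rcases List.append_eq_append_iff.1 h with ⟨r, rfl, rfl⟩ | ⟨r, rfl, h'⟩
  · exact absurd ⟨r, q, by simp⟩ (hv x)
  rcases List.append_eq_append_iff.1 h' with ⟨l, rfl, rfl⟩ | ⟨l, hl, rfl⟩
  · exact absurd ⟨p, l, by simp⟩ (hu x)
  have hlen := congrArg List.length hl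
  simp only [length_altList, List.length_append] at hlen
  have hsplit := altList_add x r.length l.length
  rw [← hlen, hl] at hsplit
  obtain ⟨hr, hl'⟩ := List.append_inj hsplit (by simp)
  refine ⟨x, p, q, r.length, ?_, ?_, by rw [← hr], ?_, hp⟩
  · rcases r with _ | ⟨y, r⟩
    · exact absurd ⟨[], q, by simp [hl]⟩ (hv x)
    · simp
  · rcases l with _ | ⟨y, l⟩
    · exact absurd ⟨p, [], by simp [hl]⟩ (hu x)
    · simp at hlen; omega
  · rw [show 2 * k - r.length = l.length by omega, ← hl']

lemma getLast?_append_altList (p : List Bool) (x : Bool) {i : ℕ} (hi : 0 < i) :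
    (p ++ altList x i).getLast? = some (!(not^[i] x)) := by
  obtain ⟨i, rfl⟩ := Nat.exists_eq_succ_of_ne_zero hi.ne'
  rw [List.getLast?_append, getLast?_altList, Nat.succ_eq_add_one,
    Function.iterate_succ_apply', Bool.not_not]
  rfl

lemma head?_altList_append (x : Bool) {i : ℕ} (hi : 0 < i) (q : List Bool) :
    (altList x i ++ q).head? = some x := by
  rw [List.head?_append, head?_altList x hi]
  rfl

lemma reduced_append_of_getLast?_eq_head? {k : ℕ} {u v : List Bool} (hu : Reduced (2 * k) u)
    (hv : Reduced (2 * k) v) {x : Bool} (hx : u.getLast? ≠ some (!x))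
    (hx' : v.head? = some x) : Reduced (2 * k) (u ++ v) := by
  by_contra h
  obtain ⟨y, p, q, i, hi, hik, rfl, rfl, -⟩ := exists_straddle hu hv h
  rw [head?_altList_append _ (by omega), Option.some_inj] at hx'
  rw [getLast?_append_altList _ _ hi, hx'] at hx
  exact hx rfl

/-- The word representing the `j`-th power of the theta element. -/
def thetaPow (k j : ℕ) : List Bool := (List.replicate j (altList true (2 * k - 1))).flatten

lemma thetaPow_succ (k j : ℕ) :
    thetaPow k (j + 1) = altList true (2 * k - 1) ++ thetaPow k j := by
  simp [thetaPow, List.replicate_succ]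

lemma thetaPow_succ' (k j : ℕ) :
    thetaPow k (j + 1) = thetaPow k j ++ altList true (2 * k - 1) := by
  simp [thetaPow, List.replicate_succ']

lemma head?_thetaPow {k : ℕ} (hk : 0 < k) (j : ℕ) : (thetaPow k (j + 1)).head? = some true := by
  rw [thetaPow_succ, head?_altList_append _ (by omega)]

lemma getLast?_thetaPow {k : ℕ} (hk : 0 < k) (j : ℕ) :
    (thetaPow k (j + 1)).getLast? = some true := by
  rw [thetaPow_succ', getLast?_append_altList _ _ (by omega), iterate_not_two_mul_sub_one hk]
  rfl

lemma reduced_thetaPow {k : ℕ} (hk : 0 < k) (j : ℕ) : Reduced (2 * k) (thetaPow k j) := by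
  induction j with
  | zero => exact reduced_nil (by omega)
  | succ j ih =>
    rw [thetaPow_succ]
    refine reduced_altList_append (by omega) ih ?_
    rw [iterate_not_two_mul_sub_one hk]
    rcases j with _ | j
    · simp [thetaPow]
    · simp [head?_thetaPow hk]

lemma altList_true_append {k : ℕ} (hk : 0 < k) :
    altList true (2 * k - 1) ++ [false] = altList true (2 * k) := by
  conv_rhs => rw [show 2 * k = (2 * k - 1) + 1 by omega, altList_add,
    iterate_not_two_mul_sub_one hk]
  rfl

lemma sBlocks_thetaPow {k : ℕ} (hk : 0 < k) (j : ℕ) :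
    sBlocks (thetaPow k (j + 1)) = (k - 1) * (j + 1) + 1 := by
  have h1 : sBlocks (altList true (2 * k - 1)) = k := by
    have := sBlocks_append (altList true (2 * k - 1)) [false]
    rw [altList_true_append hk, sBlocks_altList] at this
    simpa [sBlocks] using this.symm
  induction j with
  | zero => simp [thetaPow, h1]; omega
  | succ j ih =>
    rw [thetaPow_succ']
    have := sBlocks_append (thetaPow k (j + 1)) (altList true (2 * k - 1))
    rw [getLast?_thetaPow hk, head?_altList _ (by omega), if_pos ⟨rfl, rfl⟩, ih, h1] at this
    rw [mul_add (k - 1) (j + 1) 1]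
    omega

/-- A power of theta ends in a maximal alternating word only by ending in theta. -/
lemma thetaPow_eq_append_altList {k j i : ℕ} {p : List Bool} {x : Bool}
    (h : thetaPow k (j + 1) = p ++ altList x i) (hi : 0 < i) (hik : i < 2 * k)
    (hp : p.getLast? ≠ some (!x)) : x = true ∧ i = 2 * k - 1 ∧ p = thetaPow k j := by
  rw [thetaPow_succ', show 2 * k - 1 = (2 * k - 1 - i) + i by omega, altList_add,
    ← List.append_assoc] at h
  obtain ⟨rfl, h2⟩ := List.append_inj' h (by simp)
  have hx := congrArg List.head? h2
  rw [head?_altList _ hi, head?_altList _ hi, Option.some_inj] at hx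
  rcases Nat.eq_zero_or_pos (2 * k - 1 - i) with h0 | h0
  · rw [h0] at hx ⊢
    exact ⟨hx.symm, by omega, by simp [altList]⟩
  · rw [getLast?_append_altList _ _ h0, hx] at hp
    exact absurd rfl hp

/-- A power of theta begins with a maximal alternating word only by beginning with theta. -/
lemma thetaPow_eq_altList_append {k j i : ℕ} {q : List Bool} {x : Bool}
    (h : thetaPow k (j + 1) = altList x i ++ q) (hi : 0 < i) (hik : i < 2 * k)
    (hq : q.head? ≠ some (not^[i] x)) : x = true ∧ i = 2 * k - 1 ∧ q = thetaPow k j := by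
  rw [thetaPow_succ, show 2 * k - 1 = i + (2 * k - 1 - i) by omega, altList_add,
    List.append_assoc] at h
  obtain ⟨h1, rfl⟩ := List.append_inj h (by simp)
  have hx := congrArg List.head? h1
  rw [head?_altList _ hi, head?_altList _ hi, Option.some_inj] at hx
  subst hx
  rcases Nat.eq_zero_or_pos (2 * k - 1 - i) with h0 | h0
  · exact ⟨rfl, by omega, by simp [h0, altList]⟩
  · rw [head?_altList_append _ h0] at hq
    exact absurd rfl hq

/-- The relation between two reduced words `u`, `v` and the `Δ`-form `c Δ ^ n` of their
product, expressed in terms of numbers of blocks. -/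
structure IsProductForm (k : ℕ) (u v c : List Bool) (n ε : ℕ) : Prop where
  reduced : Reduced (2 * k) c
  eval_eq : evalWord (2 * k) u * evalWord (2 * k) v = evalWord (2 * k) c * Ωd (2 * k) ^ n
  le_one : ε ≤ 1
  sBlocks_eq : sBlocks c + (k - 1) * n + ε = sBlocks u + sBlocks v
  left_theta : ∀ j, u = thetaPow k (j + 1) → true ∈ v → ε = 1
  right_theta : ∀ j, v = thetaPow k (j + 1) → true ∈ u → ε = 1
  result_mem : true ∉ c → true ∈ u ∨ true ∈ v → ε = 1

lemma isProductForm_of_reduced {k : ℕ} (hk : 0 < k) {u v : List Bool}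
    (huv : Reduced (2 * k) (u ++ v)) :
    IsProductForm k u v (u ++ v) 0
      (if u.getLast? = some true ∧ v.head? = some true then 1 else 0) where
  reduced := huv
  eval_eq := by simp
  le_one := by split_ifs <;> simp
  sBlocks_eq := sBlocks_append u v
  left_theta := by
    rintro j rfl hv
    rw [if_pos]
    refine ⟨getLast?_thetaPow hk j, ?_⟩
    rcases v with _ | ⟨_ | _, v⟩
    · simp at hv
    · refine absurd ⟨thetaPow k j, v, ?_⟩ (huv true)
      rw [thetaPow_succ', ← altList_true_append hk]
      simp
    · rfl
  right_theta := by
    rintro j rfl hu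
    rw [if_pos]
    refine ⟨?_, head?_thetaPow hk j⟩
    rcases List.eq_nil_or_concat u with rfl | ⟨u, _ | _, rfl⟩
    · simp at hu
    · refine absurd ⟨u, thetaPow k j, ?_⟩ (huv false)
      conv_lhs => rw [show 2 * k = (2 * k - 1) + 1 by omega]
      rw [thetaPow_succ]
      simp [altList]
    · simp
  result_mem := by
    intro h h'
    simp at h
    tauto

lemma exists_isProductForm {k : ℕ} (hk : 0 < k) {u v : List Bool}
    (hu : Reduced (2 * k) u) (hv : Reduced (2 * k) v) :
    ∃ c n ε, IsProductForm k u v c n ε := by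
  induction hl : u.length using Nat.strong_induction_on generalizing u v with
  | _ l ih =>
  by_cases huv : Reduced (2 * k) (u ++ v)
  · exact ⟨_, _, _, isProductForm_of_reduced hk huv⟩
  obtain ⟨x, p, q, i, hi, hik, rfl, rfl, hp⟩ := exists_straddle hu hv huv
  have hpr : Reduced (2 * k) p := hu.of_infix (List.prefix_append _ _).isInfix
  have hqr : Reduced (2 * k) q := hv.of_infix (List.suffix_append _ _).isInfix
  have hflip : not^[2 * k - i] (not^[i] x) = x := by
    rw [← Function.iterate_add_apply, show 2 * k - i + i = 2 * k by omega,
      iterate_not_two_mul]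
  have hA : altList x i ++ altList (not^[i] x) (2 * k - i) = altList x (2 * k) := by
    rw [← altList_add]
    congr 1
    omega
  have heval : evalWord (2 * k) (p ++ altList x i) *
      evalWord (2 * k) (altList (not^[i] x) (2 * k - i) ++ q) =
        evalWord (2 * k) p * evalWord (2 * k) q * Ωd (2 * k) := by
    rw [← evalWord_append, List.append_assoc, ← List.append_assoc (altList x i), hA,
      evalWord_append, evalWord_append, evalWord_altList, (commute_omega k q).eq, mul_assoc]
  have hblocks : sBlocks (p ++ altList x i) +
      sBlocks (altList (not^[i] x) (2 * k - i) ++ q) +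
      (if p.getLast? = some true ∧ x = true then 1 else 0) +
      (if x = false ∧ q.head? = some true then 1 else 0) = sBlocks p + k + sBlocks q := by
    have h1 := sBlocks_append (p ++ altList x i) (altList (not^[i] x) (2 * k - i) ++ q)
    rw [getLast?_append_altList _ _ hi, head?_altList_append _ (by omega),
      if_neg (by simp), List.append_assoc, ← List.append_assoc (altList x i), hA] at h1
    have h2 := sBlocks_append p (altList x (2 * k) ++ q)
    have h3 := sBlocks_append (altList x (2 * k)) q
    have h4 := getLast?_append_altList [] x (show 0 < 2 * k by omega)
    rw [List.nil_append, iterate_not_two_mul] at h4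
    rw [head?_altList_append _ (by omega)] at h2
    rw [h4, sBlocks_altList] at h3
    rcases x <;> simp at h2 h3 ⊢ <;> omega
  by_cases hqx : q.head? = some x
  · have happ := sBlocks_append p q
    refine ⟨p ++ q, 1, 1, reduced_append_of_getLast?_eq_head? hpr hqr hp hqx, ?_, le_rfl, ?_,
      fun _ _ _ => rfl, fun _ _ _ => rfl, fun _ _ => rfl⟩
    · rw [heval, evalWord_append, pow_one]
    · rw [hqx] at happ hblocks
      rcases x <;> simp at happ hblocks <;> omega
  by_cases hend : (x = true ∧ p = []) ∨ (x = false ∧ q = [])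
  · refine ⟨p ++ q, 1, 1, ?_, ?_, le_rfl, ?_,
      fun _ _ _ => rfl, fun _ _ _ => rfl, fun _ _ => rfl⟩
    · rcases hend with ⟨-, rfl⟩ | ⟨-, rfl⟩ <;> simpa
    · rw [heval, evalWord_append, pow_one]
    · rcases hend with ⟨rfl, rfl⟩ | ⟨rfl, rfl⟩ <;> simp [sBlocks] at hblocks ⊢ <;> omega
  have hpq : (x = true ∧ p.getLast? = some true) ∨ (x = false ∧ q.head? = some true) := by
    rcases x
    · refine Or.inr ⟨rfl, ?_⟩
      rcases q with _ | ⟨_ | _, q⟩ <;> simp_all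
    · refine Or.inl ⟨rfl, ?_⟩
      rcases List.eq_nil_or_concat p with rfl | ⟨p, _ | _, rfl⟩ <;> simp_all
  obtain ⟨c, n, ε, h⟩ := ih p.length (by simp at hl; omega) hpr hqr rfl
  refine ⟨c, n + 1, ε, h.reduced, ?_, h.le_one, ?_, ?_, ?_, ?_⟩
  · rw [heval, h.eval_eq, pow_succ, mul_assoc]
  · have := h.sBlocks_eq
    rw [mul_add (k - 1) n 1]
    rcases hpq with ⟨rfl, hlast⟩ | ⟨rfl, hhead⟩
    · simp [hlast] at hblocks
      omega
    · simp [hhead] at hblocks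
      omega
  · intro j hj hmem
    obtain ⟨rfl, rfl, rfl⟩ := thetaPow_eq_append_altList hj.symm hi hik hp
    rcases j with _ | j
    · simp [thetaPow] at hpq
    · refine h.left_theta j rfl ?_
      rw [iterate_not_two_mul_sub_one hk, show 2 * k - (2 * k - 1) = 1 by omega] at hmem
      simpa [altList] using hmem
  · intro j hj hmem
    obtain ⟨hx, hi', rfl⟩ := thetaPow_eq_altList_append hj.symm (by omega) (by omega)
      (by rwa [hflip])
    obtain rfl : i = 1 := by omega
    obtain rfl : x = false := by simpa using hx
    rcases j with _ | j
    · simp [thetaPow] at hpq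
    · refine h.right_theta j rfl ?_
      simpa [altList] using hmem
  · intro hc _
    refine h.result_mem hc ?_
    rcases hpq with ⟨-, hlast⟩ | ⟨-, hhead⟩
    · exact Or.inl (List.mem_of_getLast? hlast)
    · exact Or.inr (List.mem_of_head? hhead)

lemma unmovable_evalWord_iff {k : ℕ} (hk : 0 < k) {w : List Bool} :
    Unmovable (Md (2 * k)) (Ωd (2 * k)) (evalWord (2 * k) w) ↔ Reduced (2 * k) w := by
  rw [Unmovable, leR, mem_Md, mem_Md]
  constructor
  · rintro ⟨-, h⟩ x ⟨p, q, rfl⟩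
    refine h ⟨p ++ q, ?_⟩
    rw [eq_mul_inv_iff_mul_eq, evalWord_append, evalWord_append, evalWord_append,
      evalWord_altList, mul_assoc, ← (commute_omega k q).eq, mul_assoc]
  · rintro h
    refine ⟨⟨w, rfl⟩, ?_⟩
    rintro ⟨v, hv⟩
    rw [eq_mul_inv_iff_mul_eq, ← evalWord_altList _ true, ← evalWord_append] at hv
    have := eq_of_evalWord_eq hk h hv
    exact h true ⟨v, [], by simpa using this⟩

lemma unmovable_iff {k : ℕ} (hk : 0 < k) {a : DG (2 * k)} :
    Unmovable (Md (2 * k)) (Ωd (2 * k)) a ↔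
      ∃ w, Reduced (2 * k) w ∧ evalWord (2 * k) w = a := by
  constructor
  · intro h
    obtain ⟨w, rfl⟩ := mem_Md.1 h.1
    exact ⟨w, (unmovable_evalWord_iff hk).1 h, rfl⟩
  · rintro ⟨w, hw, rfl⟩
    exact (unmovable_evalWord_iff hk).2 hw

lemma exponent_le_of_unmovable {k : ℕ} {a b : DG (2 * k)} {i j : ℤ}
    (ha : Unmovable (Md (2 * k)) (Ωd (2 * k)) a) (hb : b ∈ Md (2 * k))
    (h : a * Ωd (2 * k) ^ i = b * Ωd (2 * k) ^ j) : j ≤ i := by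
  by_contra! hlt
  obtain ⟨n, hn⟩ := Int.eq_ofNat_of_zero_le (show 0 ≤ j - i - 1 by omega)
  apply ha.2
  rw [leR, show a * (Ωd (2 * k))⁻¹ = b * Ωd (2 * k) ^ n by
    rw [← zpow_natCast, ← hn, eq_mul_inv_iff_mul_eq.2 h]
    group]
  refine mul_mem hb (pow_mem ?_ n)
  exact mem_Md.2 ⟨_, evalWord_altList _ true⟩

lemma evalWord_mem_M₁d_iff {k : ℕ} (hk : 0 < k) {w : List Bool} (hw : Reduced (2 * k) w) :
    evalWord (2 * k) w ∈ M₁d (2 * k) ↔ true ∉ w := by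
  rw [M₁d, Submonoid.mem_closure_singleton]
  constructor
  · rintro ⟨n, hn⟩
    rw [show tA (2 * k) = gen (2 * k) false from rfl, ← evalWord_replicate] at hn
    rw [← eq_of_evalWord_eq hk hw hn]
    simp
  · intro h
    refine ⟨w.length, ?_⟩
    rw [show tA (2 * k) = gen (2 * k) false from rfl, ← evalWord_replicate]
    congr 1
    symm
    exact List.eq_replicate_iff.2 ⟨rfl, fun x hx => by rcases x <;> simp_all⟩

lemma evalWord_thetaPow {k : ℕ} (hk : 0 < k) (j : ℕ) :
    evalWord (2 * k) (thetaPow k j) = (Ωd (2 * k) * (tA (2 * k))⁻¹) ^ j := by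
  have h1 : evalWord (2 * k) (altList true (2 * k - 1)) = Ωd (2 * k) * (tA (2 * k))⁻¹ := by
    rw [eq_mul_inv_iff_mul_eq, ← evalWord_altList _ true, ← altList_true_append hk]
    simp [gen, tA]
  induction j with
  | zero => simp [thetaPow]
  | succ j ih => rw [thetaPow_succ', evalWord_append, ih, h1, pow_succ]

lemma evalWord_mem_thetaSet_iff {k : ℕ} (hk : 0 < k) {w : List Bool}
    (hw : Reduced (2 * k) w) :
    evalWord (2 * k) w ∈ thetaSet (M₁d (2 * k)) (Ωd (2 * k) * (tA (2 * k))⁻¹) ↔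
      ∃ j, w = thetaPow k (j + 1) := by
  constructor
  · rintro ⟨j, hj, b, hb, h⟩
    obtain ⟨j, rfl⟩ := Nat.exists_eq_add_of_le' hj
    obtain ⟨n, rfl⟩ := Submonoid.mem_closure_singleton.1 hb
    rw [← evalWord_thetaPow hk, show tA (2 * k) = gen (2 * k) false from rfl,
      ← evalWord_replicate, ← evalWord_append] at h
    have hwn := eq_of_evalWord_eq hk hw h.symm
    rcases n with _ | n
    · exact ⟨j, by simpa using hwn.symm⟩
    · refine absurd ⟨thetaPow k j, List.replicate n false, ?_⟩ (hw true)
      rw [← hwn, ← altList_true_append hk, thetaPow_succ', List.replicate_succ]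
      simp
  · rintro ⟨j, rfl⟩
    exact ⟨j + 1, by omega, 1, one_mem _, by rw [evalWord_thetaPow hk, mul_one]⟩

lemma condA_dihedral {k : ℕ} (hk : 0 < k) :
    CondA (Md (2 * k)) (M₁d (2 * k)) (Nd (2 * k)) (Ωd (2 * k)) (k - 1) := by
  intro n hn
  obtain ⟨n, rfl⟩ := Nat.exists_eq_add_of_le' hn
  have hcomm : Commute (Ωd (2 * k)) (tA (2 * k)) := by
    simpa [gen, tA] using commute_omega k [false]
  have h : Ωd (2 * k) ^ (n + 1) =
      evalWord (2 * k) (thetaPow k (n + 1)) * gen (2 * k) false ^ (n + 1) := by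
    rw [evalWord_thetaPow hk, hcomm.inv_right.mul_pow,
      show gen (2 * k) false = tA (2 * k) from rfl, inv_pow, inv_mul_cancel_right]
  rw [h, dpt_mul_gen_pow hk (reduced_thetaPow hk _) (by simp [getLast?_thetaPow hk]),
    sBlocks_thetaPow hk]

lemma condB_dihedral {k : ℕ} (hk : 0 < k) :
    CondB (Md (2 * k)) (M₁d (2 * k)) (Nd (2 * k)) (Ωd (2 * k))
      (Ωd (2 * k) * (tA (2 * k))⁻¹) (k - 1) := by
  intro a b c t ha hb hab hc h
  obtain ⟨u, hu, rfl⟩ := (unmovable_iff hk).1 ha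
  obtain ⟨v, hv, rfl⟩ := (unmovable_iff hk).1 hb
  obtain ⟨w, n, ε, hw⟩ := exists_isProductForm hk hu hv
  have hwu := (unmovable_evalWord_iff hk).2 hw.reduced
  have heq := hw.eval_eq
  rw [h, ← zpow_natCast] at heq
  obtain rfl : t = n :=
    le_antisymm (exponent_le_of_unmovable hwu hc.1 heq.symm) (exponent_le_of_unmovable hc hwu.1 heq)
  obtain rfl := mul_right_cancel heq
  rw [thetaBar, Set.mem_union, Set.mem_union, SetLike.mem_coe, SetLike.mem_coe,
    evalWord_mem_M₁d_iff hk hu, evalWord_mem_M₁d_iff hk hv] at hab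
  refine ⟨ε, hw.le_one, ?_, ?_⟩
  · rw [dpt_evalWord hk hu, dpt_evalWord hk hv, dpt_evalWord hk hw.reduced]
    have := hw.sBlocks_eq
    zify at this
    linarith
  · rintro (hθ | hθ | hM)
    · obtain ⟨j, hj⟩ := (evalWord_mem_thetaSet_iff hk hu).1 hθ
      exact hw.left_theta j hj (by tauto)
    · obtain ⟨j, hj⟩ := (evalWord_mem_thetaSet_iff hk hv).1 hθ
      exact hw.right_theta j hj (by tauto)
    · exact hw.result_mem ((evalWord_mem_M₁d_iff hk hw.reduced).1 hM) (by tauto)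

end DihedralArtin

open GarsideOrder DihedralArtin in
/-- In the Artin group of type `I₂(m)` with `m = 2k` even (`m ≥ 4`), with `Δ = Π(s,t,m)`,
`M₁ = ⟨t⟩⁺`, `N = ⟨s⟩⁺`, `Δ₁ = t` and `θ = Δ Δ₁⁻¹`, the pair `(H, G₁)` satisfies
Condition A with constant `ζ = k - 1` and Condition B with constant `ζ = k - 1`. -/
theorem statement17 (k : ℕ) (hk : 2 ≤ k) :
    CondA (Md (2 * k)) (M₁d (2 * k)) (Nd (2 * k)) (Ωd (2 * k)) (k - 1) ∧
    CondB (Md (2 * k)) (M₁d (2 * k)) (Nd (2 * k)) (Ωd (2 * k))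
      (Ωd (2 * k) * (tA (2 * k))⁻¹) (k - 1) := by
  exact ⟨condA_dihedral (by omega), condB_dihedral (by omega)⟩
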